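/- arXiv:2112.10172 — 3 statements merged into one kernel-verified Lean document; each statement's English description precedes it below -/
import Mathlib

section
/- Let n, k, l, j be integers with n < k, j ≥ 1, and 2k² < 2l² < 2k² + j, and let s ∈ ℤ^ω. If F^{−j}(|s_{2k²+j}|) > F^{k−n}(1), then there exists an integer i ≥ 1 such that F^{−i}(|s_{2l²+i}|) > F^{l−n}(1); in particular t*_{σ^{2l²}(s)} > F^{l−n}(1). -/
noncomputable section
open Topology Filter TopologicalSpace

/- The dynamical model: F(t) = 3^t − 1 acting on ℝ × ℤ^ω (ℤ discrete, product topology). -/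

/-- `F t = 3 ^ t - 1` (real exponent). -/
def F : ℝ → ℝ := fun t => (3 : ℝ) ^ t - 1

/-- The inverse of `F` on `[0, ∞)`: `F⁻¹ t = log₃ (t + 1)`. -/
def Finv : ℝ → ℝ := fun t => Real.logb 3 (t + 1)

/-- The shift map on integer sequences. -/
def shift : (ℕ → ℤ) → (ℕ → ℤ) := fun s n => s (n + 1)

/-- The map 𝓕(t, s) = (F(t) − |s₀|, σ(s)). -/
def calF : ℝ × (ℕ → ℤ) → ℝ × (ℕ → ℤ) :=
  fun x => (F x.1 - (|x.2 0| : ℝ), shift x.2)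

/-- J(𝓕) = {x : T(𝓕ⁿ(x)) ≥ 0 for all n ≥ 0} (the case n = 0 forces T(x) ≥ 0). -/
def J : Set (ℝ × (ℕ → ℤ)) := {x | ∀ n : ℕ, 0 ≤ (calF^[n] x).1}

/-- 𝕊 = {s ∈ ℤ^ω : (t, s) ∈ J(𝓕) for some t ≥ 0}. -/
def Sset : Set (ℕ → ℤ) := {s | ∃ t : ℝ, 0 ≤ t ∧ (t, s) ∈ J}

/-- t_s = min {t ≥ 0 : (t, s) ∈ J(𝓕)} (as an infimum; for s ∈ 𝕊 it is attained). -/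
def tmin (s : ℕ → ℤ) : ℝ := sInf {t : ℝ | (t, s) ∈ J}

/-- The endpoint set E(𝓕) = {(t_s, s) : s ∈ 𝕊}, a subspace of ℝ × ℤ^ω. -/
def Efan : Set (ℝ × (ℕ → ℤ)) := {x | x.2 ∈ Sset ∧ x.1 = tmin x.2}

/-- t*_s = sup_{k ≥ 1} F^{−k}(|s_k|). -/
def tstar (s : ℕ → ℤ) : ℝ := ⨆ k : ℕ, Finv^[k + 1] (|s (k + 1)| : ℝ)

/-- X_n = {x ∈ E(𝓕) : t*_{σ^{2k²}(s(x))} > F^{k−n}(1) for all k > n}. -/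
def Xfan (n : ℕ) : Set ↥Efan :=
  {x | ∀ k : ℕ, n < k → F^[k - n] 1 < tstar (shift^[2 * k ^ 2] (x : ℝ × (ℕ → ℤ)).2)}

lemma Finv_nonneg {y : ℝ} (hy : 0 ≤ y) : 0 ≤ Finv y :=
  Real.logb_nonneg (by norm_num) (by linarith)

lemma Finv_iterate_nonneg {y : ℝ} (hy : 0 ≤ y) (m : ℕ) : 0 ≤ Finv^[m] y := by
  induction m with
  | zero => exact hy
  | succ m ih =>
    rw [Function.iterate_succ_apply']
    exact Finv_nonneg ih

lemma F_lt_of_lt_Finv {t y : ℝ} (hy : 0 ≤ y) (h : t < Finv y) : F t < y := by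
  have h3 : (3 : ℝ) ^ t < y + 1 :=
    (Real.lt_logb_iff_rpow_lt (by norm_num) (by linarith)).1 h
  unfold F
  linarith

lemma F_iterate_lt_of_lt_Finv_iterate {y : ℝ} (hy : 0 ≤ y) (m : ℕ) {t : ℝ}
    (h : t < Finv^[m] y) : F^[m] t < y := by
  induction m generalizing t with
  | zero => exact h
  | succ m ih =>
    rw [Function.iterate_succ_apply'] at h
    rw [Function.iterate_succ_apply]
    exact ih (F_lt_of_lt_Finv (Finv_iterate_nonneg hy m) h)

lemma le_F_of_one_le {t : ℝ} (ht : 1 ≤ t) : t ≤ F t := by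
  have h := one_add_mul_self_le_rpow_one_add (s := (2 : ℝ)) (by norm_num) ht
  norm_num at h
  unfold F
  linarith

lemma one_le_F_iterate_one (m : ℕ) : 1 ≤ F^[m] 1 := by
  induction m with
  | zero => exact le_rfl
  | succ m ih =>
    rw [Function.iterate_succ_apply']
    exact ih.trans (le_F_of_one_le ih)

lemma F_iterate_one_monotone : Monotone fun m : ℕ => F^[m] 1 := by
  refine monotone_nat_of_le_succ fun m => ?_
  rw [Function.iterate_succ_apply']
  exact le_F_of_one_le (one_le_F_iterate_one m)


/-- If n < k, j ≥ 1, 2k² < 2l² < 2k² + j and F^{−j}(|s_{2k²+j}|) > F^{k−n}(1),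
then some i ≥ 1 has F^{−i}(|s_{2l²+i}|) > F^{l−n}(1); in particular the supremum
t*_{σ^{2l²}(s)} (taken in [0,∞], i.e. in EReal) exceeds F^{l−n}(1). -/
theorem tstar_shift_gt (n k l j : ℕ) (s : ℕ → ℤ)
    (hnk : n < k) (hj : 1 ≤ j)
    (hkl : 2 * k ^ 2 < 2 * l ^ 2) (hlj : 2 * l ^ 2 < 2 * k ^ 2 + j)
    (hs : F^[k - n] 1 < Finv^[j] (|s (2 * k ^ 2 + j)| : ℝ)) :
    (∃ i : ℕ, 1 ≤ i ∧ F^[l - n] 1 < Finv^[i] (|s (2 * l ^ 2 + i)| : ℝ)) ∧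
    (F^[l - n] 1 : EReal) < ⨆ i : ℕ, ((Finv^[i + 1] (|s (2 * l ^ 2 + (i + 1))| : ℝ) : ℝ) : EReal) := by
  have key : ∃ i : ℕ, 1 ≤ i ∧ F^[l - n] 1 < Finv^[i] (|s (2 * l ^ 2 + i)| : ℝ) := by
    obtain ⟨a, ha⟩ := Nat.exists_eq_add_of_lt hkl
    obtain ⟨i, hi⟩ := Nat.exists_eq_add_of_lt hlj
    have hj' : j = (a + 1) + (i + 1) := by omega
    have hle : l - n ≤ (a + 1) + (k - n) := by
      have hlk : k < l := lt_of_pow_lt_pow_left₀ 2 (Nat.zero_le l) (by omega)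
      have : l ≤ k + (a + 1) := by nlinarith
      omega
    have hidx : 2 * k ^ 2 + j = 2 * l ^ 2 + (i + 1) := by omega
    refine ⟨i + 1, by omega, (F_iterate_one_monotone hle).trans_lt ?_⟩
    rw [hidx, hj', Function.iterate_add_apply] at hs
    dsimp only
    rw [Function.iterate_add_apply]
    exact F_iterate_lt_of_lt_Finv_iterate (Finv_iterate_nonneg (abs_nonneg _) _) _ hs
  refine ⟨key, ?_⟩
  obtain ⟨i, hi, h⟩ := key
  obtain ⟨i, rfl⟩ := Nat.exists_eq_add_of_le' hi
  exact lt_iSup_iff.2 ⟨i, EReal.coe_lt_coe_iff.2 h⟩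
end
end

section
/- σ𝔈_c belongs to the class σℰ: there exist a witness topology 𝒲 for σ𝔈_c, subsets E_n (n ∈ ℕ) of σ𝔈_c, and a neighborhood basis β of σ𝔈_c such that (1) σ𝔈_c = ⋃_n E_n; (2) each E_n is closed in (σ𝔈_c, 𝒲); (3) each E_n is a crowded nowhere dense subset of the subspace E_{n+1}; (4) each point of σ𝔈_c has a neighborhood containing no nonempty clopen subset of any subspace E_n; (5) for each V ∈ β and each n, the set V ∩ E_n is compact in the topology 𝒲. -/
/- Complete Erdős space 𝔈_c, realized inside the real Hilbert space ℓ². -/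

noncomputable section
open Topology Filter TopologicalSpace

/-- The set of points of ℓ² all of whose coordinates lie in {0} ∪ {1/(m+1) : m ∈ ℕ}. -/
def ErdosSet : Set (lp (fun _ : ℕ => ℝ) 2) :=
  {x | ∀ n : ℕ, x n = 0 ∨ ∃ m : ℕ, x n = 1 / (m + 1)}

/-- Complete Erdős space 𝔈_c, with the subspace (norm) topology from ℓ². -/
abbrev Ec := ↥ErdosSet

/-- The σ-product σ𝔈_c ⊆ 𝔈_c^ω : sequences which are the zero point of 𝔈_c in all but
finitely many coordinates, with the subspace topology from the product 𝔈_c^ω. -/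
def sigmaErdos : Set (ℕ → Ec) :=
  {y | {n : ℕ | (y n : lp (fun _ : ℕ => ℝ) 2) ≠ 0}.Finite}

/- Witness topologies and relative notions, stated with explicit topologies to avoid
instance ambiguity between the original topology τ and the witness topology W. -/

/-- `W` is a witness topology for `(E, τ)`: `W` is coarser than `τ`, `(E, W)` is separable
and metrizable, and every point has a `τ`-neighborhood basis of `W`-closed sets. -/
def IsWitness {E : Type*} (τ W : TopologicalSpace E) : Prop :=
  τ ≤ W ∧ @TopologicalSpace.SeparableSpace E W ∧ @TopologicalSpace.MetrizableSpace E W ∧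
    ∀ x : E, ∀ U ∈ @nhds E τ x, ∃ V ∈ @nhds E τ x, V ⊆ U ∧ @IsClosed E W V

/-- The subspace `A` of `(E, τ)` is crowded (has no isolated points). -/
def Crowded {E : Type*} (τ : TopologicalSpace E) (A : Set E) : Prop :=
  ∀ x ∈ A, (@nhdsWithin E τ x (A \ {x})).NeBot

/-- `A` is a nowhere dense subset of the subspace `B` of `(E, τ)`. -/
def NowhereDenseIn {E : Type*} (τ : TopologicalSpace E) (A B : Set E) : Prop :=
  A ⊆ B ∧ @IsNowhereDense ↥B (@instTopologicalSpaceSubtype E (· ∈ B) τ)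
    {y : ↥B | (y : E) ∈ A}

/-- `C` is a clopen subset of the subspace `A` of `(E, τ)`. -/
def ClopenIn {E : Type*} (τ : TopologicalSpace E) (A C : Set E) : Prop :=
  C ⊆ A ∧ @IsClopen ↥A (@instTopologicalSpaceSubtype E (· ∈ A) τ)
    {y : ↥A | (y : E) ∈ C}

/-- The (norm-product-subspace) topology of σ𝔈_c. -/
def sigmaTop : TopologicalSpace ↥sigmaErdos := inferInstance

theorem hasSum_sq_lp (f : lp (fun _ : ℕ => ℝ) 2) : HasSum (fun i => f i ^ 2) (‖f‖ ^ 2) := by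
  simpa using lp.hasSum_norm (p := 2) (by norm_num) f

theorem norm_lp_le_iff (f : lp (fun _ : ℕ => ℝ) 2) {r : ℝ} (hr : 0 ≤ r) :
    ‖f‖ ≤ r ↔ ∀ s : Finset ℕ, ∑ i ∈ s, f i ^ 2 ≤ r ^ 2 := by
  rw [← sq_le_sq₀ (norm_nonneg f) hr]
  exact ⟨fun h s => (sum_le_hasSum s (fun i _ => sq_nonneg _) (hasSum_sq_lp f)).trans h,
    fun h => hasSum_le_of_sum_le (hasSum_sq_lp f) h⟩

theorem memℓp_two_of_sum_sq_le {z : ℕ → ℝ} {C : ℝ} (h : ∀ s : Finset ℕ, ∑ i ∈ s, z i ^ 2 ≤ C) :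
    Memℓp z 2 := by
  refine memℓp_gen' (C := C) fun s => ?_
  simpa using h s

theorem continuous_lp_apply (i : ℕ) : Continuous fun f : lp (fun _ : ℕ => ℝ) 2 => f i :=
  (continuous_apply i).comp (lp.uniformContinuous_coe (p := 2)).continuous

/-- The set of admissible coordinates of points of 𝔈_c. -/
def coordSet : Set ℝ := insert 0 (Set.range fun m : ℕ => 1 / ((m : ℝ) + 1))

theorem isCompact_coordSet : IsCompact coordSet :=
  tendsto_one_div_add_atTop_nhds_zero_nat.isCompact_insert_range

theorem mem_ErdosSet_iff (x : lp (fun _ : ℕ => ℝ) 2) : x ∈ ErdosSet ↔ ∀ n, x n ∈ coordSet := by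
  simp only [ErdosSet, coordSet, Set.mem_ofPred_eq, Set.mem_insert_iff, Set.mem_range, eq_comm]

theorem nonneg_of_mem_coordSet {t : ℝ} (ht : t ∈ coordSet) : 0 ≤ t := by
  rcases ht with rfl | ⟨m, rfl⟩
  · exact le_rfl
  · positivity

theorem isClosed_ErdosSet : IsClosed ErdosSet := by
  have : ErdosSet = ⋂ n, {x : lp (fun _ : ℕ => ℝ) 2 | x n ∈ coordSet} := by
    ext x
    simp [mem_ErdosSet_iff]
  rw [this]
  exact isClosed_iInter fun n => isCompact_coordSet.isClosed.preimage (continuous_lp_apply n)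

theorem Ec_apply_nonneg (u : Ec) (i : ℕ) : 0 ≤ u.1 i :=
  nonneg_of_mem_coordSet ((mem_ErdosSet_iff u.1).1 u.2 i)

/-- Arbitrarily close to every point of 𝔈_c there is a coordinatewise larger one. -/
theorem exists_larger_dist_lt (u : Ec) {ε : ℝ} (hε : 0 < ε) :
    ∃ v : Ec, v ≠ u ∧ (∀ j, u.1 j ≤ v.1 j) ∧ ‖v.1 - u.1‖ < ε := by
  obtain ⟨m, hm⟩ := exists_nat_one_div_lt hε
  have hpos : 0 < 1 / ((m : ℝ) + 1) := by positivity
  have hlim : Tendsto (fun i => u.1 i ^ 2) atTop (𝓝 0) := by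
    simpa using (hasSum_sq_lp u.1).summable.tendsto_atTop_zero
  obtain ⟨i, hi⟩ := (hlim.eventually (gt_mem_nhds (pow_pos hpos 2))).exists
  have hi' : u.1 i < 1 / ((m : ℝ) + 1) := lt_of_pow_lt_pow_left₀ 2 hpos.le hi
  set w : lp (fun _ : ℕ => ℝ) 2 := lp.single 2 i (1 / ((m : ℝ) + 1) - u.1 i) with hw
  have hwi : (u.1 + w) i = 1 / ((m : ℝ) + 1) := by
    simp [hw]
  have hwj : ∀ j, j ≠ i → (u.1 + w) j = u.1 j := by
    intro j hj
    rw [hw, lp.coeFn_add, Pi.add_apply, lp.single_apply_ne 2 i _ hj, add_zero]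
  refine ⟨⟨u.1 + w, ?_⟩, ?_, ?_, ?_⟩
  · intro j
    by_cases hj : j = i
    · subst hj
      exact Or.inr ⟨m, hwi⟩
    · rw [hwj j hj]
      exact u.2 j
  · intro h
    have := congrArg (fun x : Ec => x.1 i) h
    simp only [hwi] at this
    exact hi'.ne' this
  · intro j
    by_cases hj : j = i
    · subst hj
      exact hi'.le.trans hwi.ge
    · exact (hwj j hj).ge
  · have : ‖w‖ < ε := by
      rw [hw, lp.norm_single (by norm_num), Real.norm_of_nonneg (by linarith)]
      linarith [Ec_apply_nonneg u i]
    simpa using this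

theorem norm_sub_sq_le_of_apply_le {u v : Ec} (h : ∀ j, u.1 j ≤ v.1 j) :
    ‖v.1 - u.1‖ ^ 2 ≤ ‖v.1‖ ^ 2 - ‖u.1‖ ^ 2 := by
  refine hasSum_le (fun j => ?_) (hasSum_sq_lp (v.1 - u.1))
    ((hasSum_sq_lp v.1).sub (hasSum_sq_lp u.1))
  have := Ec_apply_nonneg u j
  simp only [lp.coeFn_sub, Pi.sub_apply]
  nlinarith [h j]

/-- In a closed bounded subset of 𝔈_c, chains for the coordinatewise order have upper bounds. -/
theorem exists_upper_bound_of_isChain {C : Set Ec} (hC : IsClosed C) (hne : C.Nonempty) {M : ℝ}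
    (hM : ∀ u ∈ C, ‖u.1‖ ≤ M) (c : Set C)
    (hc : IsChain (fun u v : C => ∀ j, u.1.1 j ≤ v.1.1 j) c) :
    ∃ p : C, ∀ u ∈ c, ∀ j, u.1.1 j ≤ p.1.1 j := by
  have : Std.Refl (fun u v : C => ∀ j, u.1.1 j ≤ v.1.1 j) := ⟨fun _ _ => le_rfl⟩
  rcases c.eq_empty_or_nonempty with rfl | hcne
  · exact ⟨⟨_, hne.some_mem⟩, by simp⟩
  set A : Set ℝ := (fun u : C => ‖u.1.1‖ ^ 2) '' c
  have hAb : BddAbove A := by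
    refine ⟨M ^ 2, ?_⟩
    rintro _ ⟨u, -, rfl⟩
    exact pow_le_pow_left₀ (norm_nonneg _) (hM _ u.2) 2
  have hex : ∀ n : ℕ, ∃ u ∈ c, sSup A - (1 / ((n : ℝ) + 1)) ^ 2 < ‖u.1.1‖ ^ 2 := by
    intro n
    have hpos : 0 < (1 / ((n : ℝ) + 1)) ^ 2 := by positivity
    obtain ⟨_, ⟨u, hu, rfl⟩, h⟩ := exists_lt_of_lt_csSup (hcne.image _) (sub_lt_self (sSup A) hpos)
    exact ⟨u, hu, h⟩
  choose s hsc hs using hex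
  have hle : ∀ u ∈ c, ‖u.1.1‖ ^ 2 ≤ sSup A := fun u hu => le_csSup hAb ⟨u, hu, rfl⟩
  have key : ∀ n, ∀ u ∈ c, (∀ j, (s n).1.1 j ≤ u.1.1 j) →
      ‖u.1.1 - (s n).1.1‖ ≤ 1 / ((n : ℝ) + 1) := by
    intro n u hu h
    refine (sq_le_sq₀ (norm_nonneg _) (by positivity)).1 ?_
    have := norm_sub_sq_le_of_apply_le h
    linarith [hs n, hle u hu]
  have hcau : CauchySeq fun n => (s n).1.1 := by
    refine cauchySeq_of_le_tendsto_0 (fun n : ℕ => 1 / ((n : ℝ) + 1)) ?_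
      tendsto_one_div_add_atTop_nhds_zero_nat
    intro n m N hn hm
    rcases hc.total (hsc n) (hsc m) with h | h
    · rw [dist_comm, dist_eq_norm]
      exact (key n _ (hsc m) h).trans (one_div_le_one_div_of_le (by positivity) (by gcongr))
    · rw [dist_eq_norm]
      exact (key m _ (hsc n) h).trans (one_div_le_one_div_of_le (by positivity) (by gcongr))
  obtain ⟨p, hp⟩ := cauchySeq_tendsto_of_complete hcau
  have hCcl : IsClosed (Subtype.val '' C) := isClosed_ErdosSet.isClosedMap_subtype_val C hC
  obtain ⟨q, hq, rfl⟩ := hCcl.mem_of_tendsto hp (Eventually.of_forall fun n => ⟨_, (s n).2, rfl⟩)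
  refine ⟨⟨q, hq⟩, fun u hu j => ?_⟩
  have hlim : Tendsto (fun n : ℕ => (s n).1.1 j + 1 / ((n : ℝ) + 1)) atTop (𝓝 (q.1 j + 0)) :=
    (((continuous_lp_apply j).tendsto _).comp hp).add tendsto_one_div_add_atTop_nhds_zero_nat
  rw [add_zero] at hlim
  refine ge_of_tendsto' hlim fun n => ?_
  rcases hc.total hu (hsc n) with h | h
  · have : 0 < 1 / ((n : ℝ) + 1) := by positivity
    linarith [h j]
  · have h1 := (lp.norm_apply_le_norm (p := 2) (by norm_num) (u.1.1 - (s n).1.1) j).trans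
      (key n u hu h)
    have h2 := (le_abs_self _).trans h1
    simp only [lp.coeFn_sub, Pi.sub_apply] at h2
    linarith

/-- Erdős: nonempty clopen subsets of 𝔈_c are unbounded. -/
theorem not_bounded_of_isClopen {C : Set Ec} (hC : IsClopen C) (hne : C.Nonempty) (M : ℝ) :
    ¬ ∀ u ∈ C, ‖u.1‖ ≤ M := by
  intro hM
  obtain ⟨u, hu⟩ := exists_maximal_of_chains_bounded
    (r := fun u v : C => ∀ j, u.1.1 j ≤ v.1.1 j)
    (exists_upper_bound_of_isChain hC.isClosed hne hM) (fun h₁ h₂ j => (h₁ j).trans (h₂ j))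
  obtain ⟨ε, hε, hball⟩ := Metric.isOpen_iff.1 hC.isOpen u.1 u.2
  obtain ⟨v, hvu, hle, hlt⟩ := exists_larger_dist_lt u.1 hε
  have hv : v ∈ C := hball (by rwa [Metric.mem_ball, Subtype.dist_eq, dist_eq_norm])
  have hge := hu ⟨v, hv⟩ hle
  exact hvu (Subtype.ext (lp.ext (funext fun j => le_antisymm (hge j) (hle j))))

/-- The array of all real coordinates of a point of σ𝔈_c. -/
def coordMap (y : sigmaErdos) : ℕ → ℕ → ℝ := fun k i => (y.1 k).1 i

/-- The topology of coordinatewise convergence on σ𝔈_c. -/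
@[reducible] def coordTop : TopologicalSpace sigmaErdos :=
  TopologicalSpace.induced coordMap inferInstance

theorem coordMap_injective : Function.Injective coordMap := fun _ _ h =>
  Subtype.ext (funext fun k => Subtype.ext (lp.ext (congrFun h k)))

theorem isInducing_coordMap : @IsInducing _ _ coordTop _ coordMap :=
  letI := coordTop
  ⟨rfl⟩

theorem continuous_coordMap_apply (k i : ℕ) :
    @Continuous _ _ coordTop _ fun y : sigmaErdos => (y.1 k).1 i :=
  let := coordTop
  (continuous_apply i).comp ((continuous_apply k).comp isInducing_coordMap.continuous)

theorem continuous_sigmaErdos_apply (k : ℕ) :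
    Continuous fun y : sigmaErdos => (y.1 k).1 :=
  continuous_subtype_val.comp ((continuous_apply k).comp continuous_subtype_val)

theorem le_coordTop : (instTopologicalSpaceSubtype : TopologicalSpace sigmaErdos) ≤ coordTop := by
  rw [← continuous_iff_le_induced]
  exact continuous_pi fun k => continuous_pi fun i =>
    (continuous_lp_apply i).comp (continuous_sigmaErdos_apply k)

theorem isClosed_norm_sub_le (k : ℕ) (a : lp (fun _ : ℕ => ℝ) 2) {r : ℝ} (hr : 0 ≤ r) :
    @IsClosed _ coordTop {y : sigmaErdos | ‖(y.1 k).1 - a‖ ≤ r} := by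
  let := coordTop
  simp only [norm_lp_le_iff _ hr, Set.ofPred_forall]
  refine isClosed_iInter fun s => isClosed_le ?_ continuous_const
  exact continuous_finsetSum _ fun i _ =>
    ((continuous_coordMap_apply k i).sub continuous_const).pow 2

theorem isCompact_norm_le {B : ℕ → ℝ} (hB : ∀ k, 0 ≤ B k) {n : ℕ} (hn : ∀ k, n < k → B k = 0) :
    @IsCompact _ coordTop {y : sigmaErdos | ∀ k, ‖(y.1 k).1‖ ≤ B k} := by
  let := coordTop
  rw [isInducing_coordMap.isCompact_iff]
  have himg : coordMap '' {y : sigmaErdos | ∀ k, ‖(y.1 k).1‖ ≤ B k} =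
      (Set.univ.pi fun _ => Set.univ.pi fun _ => coordSet) ∩
        ⋂ (k : ℕ) (s : Finset ℕ), {z : ℕ → ℕ → ℝ | ∑ i ∈ s, z k i ^ 2 ≤ B k ^ 2} := by
    ext z
    simp only [Set.mem_image, Set.mem_ofPred_eq, Set.mem_inter_iff, Set.mem_pi, Set.mem_univ,
      true_imp_iff, Set.mem_iInter]
    constructor
    · rintro ⟨y, hy, rfl⟩
      exact ⟨fun k => (mem_ErdosSet_iff _).1 (y.1 k).2,
        fun k => (norm_lp_le_iff _ (hB k)).1 (hy k)⟩
    · rintro ⟨hz, hs⟩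
      let w : ℕ → Ec := fun k =>
        ⟨⟨z k, memℓp_two_of_sum_sq_le (hs k)⟩, (mem_ErdosSet_iff _).2 (hz k)⟩
      have hw : ∀ k, ‖(w k).1‖ ≤ B k := fun k => (norm_lp_le_iff _ (hB k)).2 (hs k)
      refine ⟨⟨w, (Set.finite_Iic n).subset fun k hk => ?_⟩, hw, rfl⟩
      by_contra hkn
      have h := hw k
      rw [hn k (not_le.1 hkn), norm_le_zero_iff] at h
      exact hk h
  rw [himg]
  refine (isCompact_univ_pi fun _ => isCompact_univ_pi fun _ => isCompact_coordSet).inter_right ?_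
  refine isClosed_iInter fun k => isClosed_iInter fun s => isClosed_le ?_ continuous_const
  fun_prop

/-- The basic neighborhoods of `x`, given by closed balls in the coordinates up to `N`. -/
def basicNhd (x : sigmaErdos) (N : ℕ) (r : ℕ → ℝ) : Set sigmaErdos :=
  {y | ∀ k ≤ N, ‖(y.1 k).1 - (x.1 k).1‖ ≤ r k}

theorem isClosed_basicNhd (x : sigmaErdos) (N : ℕ) {r : ℕ → ℝ} (hr : ∀ k, 0 < r k) :
    @IsClosed _ coordTop (basicNhd x N r) := by
  let := coordTop
  simp only [basicNhd, Set.ofPred_forall]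
  exact isClosed_iInter fun k => isClosed_iInter fun _ => isClosed_norm_sub_le k _ (hr k).le

theorem basicNhd_mem_nhds (x : sigmaErdos) (N : ℕ) {r : ℕ → ℝ} (hr : ∀ k, 0 < r k) :
    basicNhd x N r ∈ 𝓝 x := by
  refine (eventually_all_finite (Set.finite_Iic N)).2 fun k _ => ?_
  have := (continuous_sigmaErdos_apply k).continuousAt.eventually
    (Metric.closedBall_mem_nhds (x.1 k).1 (hr k))
  simpa only [Metric.mem_closedBall, dist_eq_norm] using this

theorem exists_basicNhd_subset {x : sigmaErdos} {U : Set sigmaErdos} (hU : U ∈ 𝓝 x) :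
    ∃ (N : ℕ) (r : ℕ → ℝ), (∀ k, 0 < r k) ∧ basicNhd x N r ⊆ U := by
  rw [nhds_subtype_eq_comap, nhds_pi] at hU
  obtain ⟨S, hS, hSU⟩ := hU
  obtain ⟨I, hI, t, ht, hIS⟩ := Filter.mem_pi.1 hS
  choose r hr hrt using fun k => Metric.nhds_basis_closedBall.mem_iff.1 (ht k)
  obtain ⟨N, hN⟩ := hI.bddAbove
  refine ⟨N, r, hr, fun y hy => hSU (hIS fun k hk => hrt k ?_)⟩
  rw [Metric.mem_closedBall, Subtype.dist_eq, dist_eq_norm]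
  exact hy k (hN hk)

theorem isWitness_coordTop : IsWitness sigmaTop coordTop := by
  have hsig : sigmaTop = instTopologicalSpaceSubtype := rfl
  rw [hsig]
  refine ⟨le_coordTop, ?_, ?_, ?_⟩
  · let := coordTop
    have := isInducing_coordMap.secondCountableTopology
    infer_instance
  · let := coordTop
    exact IsEmbedding.metrizableSpace ⟨isInducing_coordMap, coordMap_injective⟩
  · intro x U hU
    obtain ⟨N, r, hr, hsub⟩ := exists_basicNhd_subset hU
    exact ⟨_, basicNhd_mem_nhds x N hr, hsub, isClosed_basicNhd x N hr⟩

/-- The points of σ𝔈_c supported on the coordinates `≤ n`, whose coordinates `1, …, n` have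
norm at most `n`; the coordinate `0` is unrestricted. -/
def stratum (n : ℕ) : Set sigmaErdos :=
  {y | ∀ k, 1 ≤ k → ‖(y.1 k).1‖ ≤ if k ≤ n then (n : ℝ) else 0}

theorem stratum_mono : Monotone stratum := by
  intro m n hmn y hy k hk
  refine (hy k hk).trans ?_
  have : (m : ℝ) ≤ n := by exact_mod_cast hmn
  split_ifs with h₁ h₂
  · exact this
  · omega
  · positivity
  · exact le_rfl

theorem iUnion_stratum : ⋃ n, stratum n = Set.univ := by
  refine Set.eq_univ_of_forall fun y => Set.mem_iUnion.2 ?_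
  obtain ⟨N, hN⟩ := y.2.bddAbove
  obtain ⟨M, hM⟩ := ((Set.finite_Iic N).image fun k => ‖(y.1 k).1‖).bddAbove
  obtain ⟨m, hm⟩ := exists_nat_ge M
  refine ⟨max N m, fun k _ => ?_⟩
  by_cases hk : k ≤ N
  · rw [if_pos (hk.trans (le_max_left _ _))]
    have h₁ : ‖(y.1 k).1‖ ≤ M := hM ⟨k, hk, rfl⟩
    have h₂ : (m : ℝ) ≤ (max N m : ℕ) := by exact_mod_cast le_max_right _ _
    linarith
  · have : (y.1 k).1 = 0 := by
      by_contra h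
      exact hk (hN h)
    rw [this, norm_zero]
    positivity

theorem isClosed_stratum (n : ℕ) : @IsClosed _ coordTop (stratum n) := by
  let := coordTop
  simp only [stratum, Set.ofPred_forall]
  refine isClosed_iInter fun k => isClosed_iInter fun _ => ?_
  have h := isClosed_norm_sub_le k 0 (r := if k ≤ n then (n : ℝ) else 0) (by positivity)
  simpa only [sub_zero] using h

theorem isCompact_basicNhd_inter_stratum (x : sigmaErdos) (N : ℕ) {r : ℕ → ℝ}
    (hr : ∀ k, 0 < r k) (n : ℕ) : @IsCompact _ coordTop (basicNhd x N r ∩ stratum n) := by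
  let := coordTop
  let B : ℕ → ℝ := fun k =>
    if k = 0 then ‖(x.1 0).1‖ + r 0 else if k ≤ n then (n : ℝ) else 0
  have hB : ∀ k, 0 ≤ B k := by
    intro k
    have := hr 0
    positivity
  have hn : ∀ k, n < k → B k = 0 := by
    intro k hk
    simp only [B]
    rw [if_neg (by omega), if_neg (by omega)]
  refine (isCompact_norm_le hB hn).of_isClosed_subset
    ((isClosed_basicNhd x N hr).inter (isClosed_stratum n)) ?_
  rintro y ⟨hy, hyn⟩ k
  simp only [B]
  split_ifs with h0
  · subst h0
    have h₁ := hy 0 (Nat.zero_le N)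
    have h₂ := norm_sub_norm_le (y.1 0).1 (x.1 0).1
    linarith
  all_goals
    have h := hyn k (by omega)
    simpa [*] using h

/-- Replace the `k`-th coordinate of a point of σ𝔈_c. -/
def updateCoord (y : sigmaErdos) (k : ℕ) (u : Ec) : sigmaErdos :=
  ⟨Function.update y.1 k u, (y.2.insert k).subset fun j hj => by
    by_cases h : j = k
    · exact Or.inl h
    · refine Or.inr ?_
      simpa [Function.update_of_ne h] using hj⟩

theorem updateCoord_self (y : sigmaErdos) (k : ℕ) (u : Ec) : (updateCoord y k u).1 k = u :=
  Function.update_self ..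

theorem updateCoord_of_ne (y : sigmaErdos) {j k : ℕ} (h : j ≠ k) (u : Ec) :
    (updateCoord y k u).1 j = y.1 j :=
  Function.update_of_ne h ..

theorem updateCoord_eq_self (y : sigmaErdos) (k : ℕ) : updateCoord y k (y.1 k) = y :=
  Subtype.ext (Function.update_eq_self ..)

theorem continuous_updateCoord (y : sigmaErdos) (k : ℕ) : Continuous (updateCoord y k) :=
  Continuous.subtype_mk (f := fun u : Ec => Function.update y.1 k u)
    (continuous_const.update k continuous_id) _

theorem updateCoord_zero_mem_stratum {y : sigmaErdos} {n : ℕ} (hy : y ∈ stratum n) (u : Ec) :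
    updateCoord y 0 u ∈ stratum n := by
  intro k hk
  rw [updateCoord_of_ne y (by omega)]
  exact hy k hk

theorem exists_ne_updateCoord_mem (y : sigmaErdos) (k : ℕ) {U : Set sigmaErdos} (hU : U ∈ 𝓝 y)
    {ε : ℝ} (hε : 0 < ε) :
    ∃ u : Ec, u ≠ y.1 k ∧ ‖u.1 - (y.1 k).1‖ < ε ∧ updateCoord y k u ∈ U := by
  have hcont := (continuous_updateCoord y k).continuousAt (x := y.1 k)
  have hpre : updateCoord y k ⁻¹' U ∈ 𝓝 (y.1 k) := by
    apply hcont
    rwa [updateCoord_eq_self]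
  obtain ⟨δ, hδ, hball⟩ := Metric.mem_nhds_iff.1 hpre
  obtain ⟨u, hne, -, hlt⟩ := exists_larger_dist_lt (y.1 k) (lt_min hε hδ)
  refine ⟨u, hne, hlt.trans_le (min_le_left _ _), hball ?_⟩
  rw [Metric.mem_ball, Subtype.dist_eq, dist_eq_norm]
  exact hlt.trans_le (min_le_right _ _)

theorem crowded_stratum (n : ℕ) : Crowded sigmaTop (stratum n) := by
  have hsig : sigmaTop = instTopologicalSpaceSubtype := rfl
  rw [hsig]
  intro y hy
  rw [← mem_closure_iff_nhdsWithin_neBot, mem_closure_iff_nhds]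
  intro U hU
  obtain ⟨u, hne, -, hu⟩ := exists_ne_updateCoord_mem y 0 hU one_pos
  refine ⟨_, hu, updateCoord_zero_mem_stratum hy u, fun h => hne ?_⟩
  rw [← updateCoord_self y 0 u, Set.mem_singleton_iff.1 h]

theorem nowhereDenseIn_stratum (n : ℕ) :
    NowhereDenseIn sigmaTop (stratum n) (stratum (n + 1)) := by
  have hsig : sigmaTop = instTopologicalSpaceSubtype := rfl
  rw [hsig]
  refine ⟨stratum_mono n.le_succ, ?_⟩
  have hcl : IsClosed (stratum n) := (isClosed_stratum n).mono le_coordTop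
  have hcl' : IsClosed {y : stratum (n + 1) | (y : sigmaErdos) ∈ stratum n} :=
    hcl.preimage continuous_subtype_val
  rw [hcl'.isNowhereDense_iff, Set.eq_empty_iff_forall_notMem]
  intro y hy
  obtain ⟨U, hU, hUs⟩ := mem_nhds_subtype _ _ _ |>.1 (mem_interior_iff_mem_nhds.1 hy)
  have hyn : (y : sigmaErdos) ∈ stratum n := by
    simpa only [Set.mem_ofPred_eq] using interior_subset hy
  have hzero : ∀ z ∈ stratum n, (z.1 (n + 1)).1 = 0 := by
    intro z hz
    have h := hz (n + 1) (by omega)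
    rwa [if_neg (by omega), norm_le_zero_iff] at h
  obtain ⟨u, hne, hlt, hu⟩ := exists_ne_updateCoord_mem y.1 (n + 1) hU one_pos
  have hmem : updateCoord y.1 (n + 1) u ∈ stratum (n + 1) := by
    intro k hk
    by_cases h : k = n + 1
    · subst h
      rw [updateCoord_self, if_pos le_rfl]
      rw [hzero _ hyn, sub_zero] at hlt
      push_cast
      have : (0 : ℝ) ≤ n := n.cast_nonneg
      linarith
    · rw [updateCoord_of_ne _ h]
      exact y.2 k hk
  have hin : updateCoord y.1 (n + 1) u ∈ stratum n := hUs (a := ⟨_, hmem⟩) hu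
  refine hne (Subtype.ext ?_)
  rw [hzero _ hyn, ← hzero _ hin, updateCoord_self]

theorem not_subset_of_clopenIn_stratum (x : sigmaErdos) (n : ℕ) {C : Set sigmaErdos}
    (hC : ClopenIn sigmaTop (stratum n) C) (hne : C.Nonempty) {r : ℕ → ℝ} :
    ¬ C ⊆ basicNhd x 0 r := by
  have hsig : sigmaTop = instTopologicalSpaceSubtype := rfl
  rw [hsig] at hC
  obtain ⟨hCs, hclopen⟩ := hC
  obtain ⟨y, hy⟩ := hne
  intro hsub
  have hpre := hclopen.preimage (((continuous_updateCoord y 0).subtype_mk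
    fun u => updateCoord_zero_mem_stratum (hCs hy) u))
  refine not_bounded_of_isClopen hpre ⟨y.1 0, ?_⟩ (‖(x.1 0).1‖ + r 0) fun u hu => ?_
  · simpa only [Set.mem_preimage, Set.mem_ofPred_eq, updateCoord_eq_self] using hy
  · have h₁ := hsub hu 0 le_rfl
    rw [updateCoord_self] at h₁
    have h₂ := norm_sub_norm_le u.1 (x.1 0).1
    linarith

/-- σ𝔈_c belongs to the class σℰ: there are a witness topology 𝒲, sets E_n and
a neighborhood basis β satisfying conditions (1)–(5). -/
theorem sigmaErdos_mem_sigmaClassE :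
    ∃ (W : TopologicalSpace ↥sigmaErdos) (En : ℕ → Set ↥sigmaErdos)
      (β : Set (Set ↥sigmaErdos)),
      IsWitness sigmaTop W ∧
      (∀ x : ↥sigmaErdos, ∀ U ∈ @nhds _ sigmaTop x, ∃ V ∈ β, V ∈ @nhds _ sigmaTop x ∧ V ⊆ U) ∧
      -- (1)
      (⋃ n, En n) = Set.univ ∧
      -- (2)
      (∀ n, @IsClosed _ W (En n)) ∧
      -- (3)
      (∀ n, Crowded sigmaTop (En n) ∧ NowhereDenseIn sigmaTop (En n) (En (n + 1))) ∧
      -- (4)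
      (∀ x : ↥sigmaErdos, ∃ U ∈ @nhds _ sigmaTop x, ∀ n, ∀ C : Set ↥sigmaErdos,
        ClopenIn sigmaTop (En n) C → C.Nonempty → ¬ C ⊆ U) ∧
      -- (5)
      (∀ V ∈ β, ∀ n, @IsCompact _ W (V ∩ En n)) := by
  refine ⟨coordTop, stratum, {V | ∃ x N r, (∀ k, 0 < r k) ∧ V = basicNhd x N r},
    isWitness_coordTop, ?_, iUnion_stratum, isClosed_stratum,
    fun n => ⟨crowded_stratum n, nowhereDenseIn_stratum n⟩, ?_, ?_⟩
  · intro x U hU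
    obtain ⟨N, r, hr, hsub⟩ := exists_basicNhd_subset hU
    exact ⟨_, ⟨x, N, r, hr, rfl⟩, basicNhd_mem_nhds x N hr, hsub⟩
  · intro x
    exact ⟨basicNhd x 0 1, basicNhd_mem_nhds x 0 fun _ => one_pos,
      fun n _ hC hne => not_subset_of_clopenIn_stratum x n hC hne⟩
  · rintro _ ⟨x, N, r, hr, rfl⟩ n
    exact isCompact_basicNhd_inter_stratum x N hr n
end
end

section
/- The space Y = ⋃_{n<ω} cl(X_n) (closures taken in E(𝓕)), with its subspace topology, is NOT homeomorphic to ℚ × 𝔈_c. -/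
/- Complete Erdős space 𝔈_c, realized inside the real Hilbert space ℓ². -/

noncomputable section
open Topology Filter TopologicalSpace

/-! ### The growth function -/

lemma F_strictMono : StrictMono F := fun a b h => by
  unfold F
  have := Real.rpow_lt_rpow_of_exponent_lt (by norm_num : (1 : ℝ) < 3) h
  linarith

lemma F_zero : F 0 = 0 := by simp [F]

lemma F_one : F 1 = 2 := by norm_num [F]

lemma continuous_F : Continuous F := by
  unfold F
  exact (Real.continuous_const_rpow (by norm_num)).sub continuous_const

lemma F_nonneg {a : ℝ} (ha : 0 ≤ a) : 0 ≤ F a := by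
  simpa [F_zero] using F_strictMono.monotone ha

lemma one_lt_log_three : 1 < Real.log 3 := by
  rw [Real.lt_log_iff_exp_lt (by norm_num)]
  exact Real.exp_one_lt_d9.trans (by norm_num)

lemma log_three_mul_le_F (a : ℝ) : Real.log 3 * a ≤ F a := by
  unfold F
  rw [Real.rpow_def_of_pos (by norm_num)]
  linarith [Real.add_one_le_exp (Real.log 3 * a)]

lemma le_F {a : ℝ} (ha : 0 ≤ a) : a ≤ F a := by
  nlinarith [log_three_mul_le_F a, one_lt_log_three]

lemma F_add_le {a b : ℝ} (ha : 0 ≤ a) (hb : 0 ≤ b) : F a + F b ≤ F (a + b) := by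
  have h1 := F_nonneg ha
  have h2 := F_nonneg hb
  unfold F at *
  rw [Real.rpow_add (by norm_num)]
  nlinarith

lemma F_iterate_nonneg {a : ℝ} (ha : 0 ≤ a) (m : ℕ) : 0 ≤ F^[m] a := by
  induction m with
  | zero => exact ha
  | succ m ih => rw [Function.iterate_succ_apply']; exact F_nonneg ih

lemma F_iterate_mono {a : ℝ} (ha : 0 ≤ a) : Monotone fun m => F^[m] a :=
  monotone_nat_of_le_succ fun m => by
    rw [Function.iterate_succ_apply']
    exact le_F (F_iterate_nonneg ha m)

lemma F_iterate_add_le {a b : ℝ} (ha : 0 ≤ a) (hb : 0 ≤ b) (m : ℕ) :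
    F^[m] a + F^[m] b ≤ F^[m] (a + b) := by
  induction m with
  | zero => exact le_rfl
  | succ m ih =>
    simp only [Function.iterate_succ_apply']
    exact (F_add_le (F_iterate_nonneg ha m) (F_iterate_nonneg hb m)).trans
      (F_strictMono.monotone ih)

lemma tendsto_F_iterate {a : ℝ} (ha : 0 < a) : Tendsto (fun m => F^[m] a) atTop atTop := by
  refine tendsto_atTop_mono (f := fun m : ℕ => Real.log 3 ^ m * a) (fun m => ?_)
    ((tendsto_pow_atTop_atTop_of_one_lt one_lt_log_three).atTop_mul_const ha)
  induction m with
  | zero => simp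
  | succ m ih =>
    rw [Function.iterate_succ_apply', pow_succ']
    refine le_trans ?_ (log_three_mul_le_F _)
    rw [mul_assoc]
    exact mul_le_mul_of_nonneg_left ih (by linarith [one_lt_log_three])

/-- A sequence growing fast enough to dominate the bounds defining `Xfan`, but more slowly than
every orbit of `F` on `(0, ∞)`. -/
def slowSeq (m : ℕ) : ℝ := F^[m.sqrt] 1 + 2

lemma slowSeq_nonneg (m : ℕ) : 0 ≤ slowSeq m := by
  have := F_iterate_nonneg zero_le_one m.sqrt
  unfold slowSeq
  linarith

lemma slowSeq_succ_le (m : ℕ) : slowSeq (m + 1) ≤ F (slowSeq m) := by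
  have h0 := F_iterate_nonneg zero_le_one m.sqrt
  have h1 : F^[(m + 1).sqrt] 1 ≤ F^[m.sqrt + 1] 1 :=
    F_iterate_mono zero_le_one (Nat.sqrt_succ_le_succ_sqrt m)
  rw [Function.iterate_succ_apply'] at h1
  have h2 := F_add_le h0 zero_le_two
  have h3 := le_F zero_le_two
  unfold slowSeq
  linarith

lemma eventually_slowSeq_lt {δ : ℝ} (hδ : 0 < δ) (N : ℕ) :
    ∀ᶠ i in atTop, slowSeq (N + i) + 1 < F^[i] δ := by
  obtain ⟨i₀, hi₀⟩ := ((tendsto_F_iterate hδ).eventually_ge_atTop 5).exists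
  filter_upwards [eventually_ge_atTop (4 * i₀ + N + 4)] with i hi
  obtain ⟨j, rfl⟩ : ∃ j, i = j + i₀ := ⟨i - i₀, by omega⟩
  have hs : (N + (j + i₀)).sqrt ≤ j := by
    refine (Nat.sqrt_le_sqrt (by nlinarith : N + (j + i₀) ≤ j * j)).trans ?_
    rw [Nat.sqrt_eq]
  have h1 : F^[(N + (j + i₀)).sqrt] 1 ≤ F^[j] 1 := F_iterate_mono zero_le_one hs
  have h2 : F^[j] 5 ≤ F^[j] (F^[i₀] δ) := F_strictMono.monotone.iterate j hi₀
  have h3 := F_iterate_add_le zero_le_one (by norm_num : (0 : ℝ) ≤ 4) j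
  have h4 : (4 : ℝ) ≤ F^[j] 4 := F_iterate_mono (by norm_num : (0 : ℝ) ≤ 4) (Nat.zero_le j)
  norm_num at h3
  rw [Function.iterate_add_apply]
  unfold slowSeq
  linarith

/-! ### Orbits of the model -/

/-- The first coordinate of `calF^[n] (t, s)`. -/
def orb (t : ℝ) (s : ℕ → ℤ) : ℕ → ℝ
  | 0 => t
  | n + 1 => F (orb t s n) - |(s n : ℝ)|

lemma shift_iterate (s : ℕ → ℤ) (n k : ℕ) : shift^[n] s k = s (n + k) := by
  induction n generalizing k with
  | zero => simp
  | succ n ih =>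
    rw [Function.iterate_succ_apply']
    simp only [shift, ih]
    congr 1
    omega

lemma calF_iterate (t : ℝ) (s : ℕ → ℤ) (n : ℕ) : calF^[n] (t, s) = (orb t s n, shift^[n] s) := by
  induction n with
  | zero => rfl
  | succ n ih =>
    rw [Function.iterate_succ_apply', ih, Function.iterate_succ_apply']
    simp [calF, orb, shift_iterate]

/-- The points whose orbit is bounded below by `b`. -/
def lowerBdd (b : ℕ → ℝ) : Set (ℝ × (ℕ → ℤ)) := {p | ∀ m, b m ≤ orb p.1 p.2 m}

lemma J_eq : J = lowerBdd 0 := by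
  ext ⟨t, s⟩
  simp [J, lowerBdd, calF_iterate]

lemma lowerBdd_anti {b b' : ℕ → ℝ} (h : b ≤ b') : lowerBdd b' ⊆ lowerBdd b :=
  fun _ hp m => (h m).trans (hp m)

lemma lowerBdd_subset_J {b : ℕ → ℝ} (hb : 0 ≤ b) : lowerBdd b ⊆ J := by
  rw [J_eq]
  exact lowerBdd_anti hb

lemma orb_succ_le (t : ℝ) (s : ℕ → ℤ) (m : ℕ) : orb t s (m + 1) ≤ F (orb t s m) := by
  simp [orb]

lemma continuous_orb (m : ℕ) : Continuous fun p : ℝ × (ℕ → ℤ) => orb p.1 p.2 m := by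
  induction m with
  | zero => exact continuous_fst
  | succ m ih =>
    simp only [orb]
    have : Continuous fun p : ℝ × (ℕ → ℤ) => ((p.2 m : ℤ) : ℝ) :=
      (continuous_of_discreteTopology (f := fun z : ℤ => (z : ℝ))).comp
        ((continuous_apply m).comp continuous_snd)
    exact (continuous_F.comp ih).sub this.abs

lemma isClosed_lowerBdd (b : ℕ → ℝ) : IsClosed (lowerBdd b) := by
  simp only [lowerBdd, Set.ofPred_forall]
  exact isClosed_iInter fun m => isClosed_le continuous_const (continuous_orb m)

lemma orb_congr (t : ℝ) {s s' : ℕ → ℤ} {m : ℕ} (h : ∀ i < m, s' i = s i) :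
    orb t s' m = orb t s m := by
  induction m with
  | zero => rfl
  | succ m ih =>
    simp only [orb, ih fun i hi => h i (hi.trans m.lt_succ_self), h m m.lt_succ_self]

lemma orb_mono {t t' : ℝ} (h : t ≤ t') (s : ℕ → ℤ) (m : ℕ) : orb t s m ≤ orb t' s m := by
  induction m with
  | zero => exact h
  | succ m ih => simp only [orb]; linarith [F_strictMono.monotone ih]

lemma lowerBdd_up {b : ℕ → ℝ} {t t' : ℝ} {s : ℕ → ℤ} (h : t ≤ t') (hp : (t, s) ∈ lowerBdd b) :
    (t', s) ∈ lowerBdd b := fun m => (hp m).trans (orb_mono h s m)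

lemma J_up {t t' : ℝ} {s : ℕ → ℤ} (h : t ≤ t') (hp : (t, s) ∈ J) : (t', s) ∈ J := by
  rw [J_eq] at *
  exact lowerBdd_up h hp

lemma orb_add_F_iterate_le {t δ : ℝ} {s : ℕ → ℤ} (hδ : 0 ≤ δ) {m : ℕ}
    (h : ∀ i < m, 0 ≤ orb t s i) : orb t s m + F^[m] δ ≤ orb (t + δ) s m := by
  induction m with
  | zero => exact le_rfl
  | succ m ih =>
    have h1 := ih fun i hi => h i (hi.trans m.lt_succ_self)
    have h2 := F_add_le (h m m.lt_succ_self) (F_iterate_nonneg hδ m)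
    have h3 := F_strictMono.monotone h1
    rw [Function.iterate_succ_apply']
    simp only [orb]
    linarith

lemma orb_nonneg {t : ℝ} {s : ℕ → ℤ} (h : (t, s) ∈ J) (m : ℕ) : 0 ≤ orb t s m := by
  rw [J_eq] at h
  exact h m

lemma mem_Efan_iff {t : ℝ} {s : ℕ → ℤ} :
    (t, s) ∈ Efan ↔ (t, s) ∈ J ∧ ∀ t' < t, (t', s) ∉ J := by
  have hbd : BddBelow {t : ℝ | (t, s) ∈ J} := ⟨0, fun u hu => orb_nonneg hu 0⟩
  constructor
  · rintro ⟨⟨u, -, hu⟩, rfl : t = tmin s⟩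
    refine ⟨?_, fun t' ht' h => ht'.not_ge (csInf_le hbd h)⟩
    refine IsClosed.csInf_mem (s := {t : ℝ | (t, s) ∈ J}) ?_ ⟨u, hu⟩ hbd
    rw [J_eq]
    exact (isClosed_lowerBdd 0).preimage (by fun_prop : Continuous fun t : ℝ => (t, s))
  · rintro ⟨h, h'⟩
    refine ⟨⟨t, orb_nonneg h 0, h⟩, ?_⟩
    exact (IsLeast.csInf_eq (s := {t : ℝ | (t, s) ∈ J})
      ⟨h, fun u hu => not_lt.1 fun hlt => h' u hlt hu⟩).symm

lemma exists_agree_lt_of_mem_Efan {t ε : ℝ} {s : ℕ → ℤ} (h : (t, s) ∈ Efan) (hε : 0 < ε) :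
    ∃ N : ℕ, ∀ t' s', (t', s') ∈ J → (∀ i < N, s' i = s i) → t - ε < t' := by
  have h1 := (mem_Efan_iff.1 h).2 (t - ε) (by linarith)
  simp only [J_eq, lowerBdd, Set.mem_ofPred_eq, not_forall, not_le] at h1
  obtain ⟨m, hm⟩ := h1
  refine ⟨m, fun t' s' hJ hs => not_le.1 fun hle => ?_⟩
  have h2 := orb_nonneg (J_up hle hJ) m
  rw [orb_congr _ hs] at h2
  exact hm.not_ge h2

/-! ### Density of slowly escaping endpoints -/

/-- The digit at position `m` of the itinerary which follows `s` for `N` steps and then keeps the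
orbit, currently at `τ`, just above `slowSeq`. -/
def greedyStep (s : ℕ → ℤ) (N m : ℕ) (τ : ℝ) : ℤ :=
  if m < N then s m else max 0 ⌊F τ - slowSeq (m + 1)⌋

/-- The orbit of `t` under the greedy itinerary. -/
def greedyOrb (t : ℝ) (s : ℕ → ℤ) (N : ℕ) : ℕ → ℝ
  | 0 => t
  | m + 1 => F (greedyOrb t s N m) - |(greedyStep s N m (greedyOrb t s N m) : ℝ)|

/-- The greedy itinerary of `t`. -/
def greedySeq (t : ℝ) (s : ℕ → ℤ) (N m : ℕ) : ℤ := greedyStep s N m (greedyOrb t s N m)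

lemma orb_greedySeq (t : ℝ) (s : ℕ → ℤ) (N m : ℕ) :
    orb t (greedySeq t s N) m = greedyOrb t s N m := by
  induction m with
  | zero => rfl
  | succ m ih => simp only [orb, greedyOrb, ih, greedySeq]

lemma greedySeq_of_lt (t : ℝ) (s : ℕ → ℤ) {N m : ℕ} (h : m < N) : greedySeq t s N m = s m := by
  simp [greedySeq, greedyStep, h]

lemma min_le_greedyOrb (t : ℝ) (s : ℕ → ℤ) (N m : ℕ) :
    min (slowSeq m) (orb t s m) ≤ greedyOrb t s N m := by
  have hle : ∀ m ≤ N, min (slowSeq m) (orb t s m) ≤ greedyOrb t s N m := fun m hm => by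
    rw [← orb_greedySeq, orb_congr t (s := s) fun i hi => greedySeq_of_lt t s (hi.trans_le hm)]
    exact min_le_right _ _
  rcases le_total m N with hm | hm
  · exact hle m hm
  induction m, hm using Nat.le_induction with
  | base => exact hle N le_rfl
  | succ m hm ih =>
    simp only [greedyOrb, greedyStep, hm.not_gt, if_false]
    rcases le_total ⌊F (greedyOrb t s N m) - slowSeq (m + 1)⌋ 0 with h0 | h0
    · rw [max_eq_left h0, Int.cast_zero, abs_zero, sub_zero]
      rcases min_le_iff.1 ih with h1 | h1
      · exact (min_le_left _ _).trans ((slowSeq_succ_le m).trans (F_strictMono.monotone h1))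
      · exact (min_le_right _ _).trans ((orb_succ_le t s m).trans (F_strictMono.monotone h1))
    · rw [max_eq_right h0, abs_of_nonneg (Int.cast_nonneg h0)]
      have := Int.floor_le (F (greedyOrb t s N m) - slowSeq (m + 1))
      exact (min_le_left _ _).trans (by linarith)

lemma greedyOrb_succ_le (t : ℝ) (s : ℕ → ℤ) {N m : ℕ} (h : N ≤ m) :
    greedyOrb t s N (m + 1) ≤ slowSeq (m + 1) + 1 := by
  simp only [greedyOrb, greedyStep, h.not_gt, if_false]
  have h1 := Int.lt_floor_add_one (F (greedyOrb t s N m) - slowSeq (m + 1))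
  have h2 : ((⌊F (greedyOrb t s N m) - slowSeq (m + 1)⌋ : ℤ) : ℝ) ≤
      ((max 0 ⌊F (greedyOrb t s N m) - slowSeq (m + 1)⌋ : ℤ) : ℝ) :=
    Int.cast_le.2 (le_max_right _ _)
  have h3 := le_abs_self ((max 0 ⌊F (greedyOrb t s N m) - slowSeq (m + 1)⌋ : ℤ) : ℝ)
  linarith

/-- Endpoints are dense in every region of orbits bounded below by a slow sequence, and the
approximating endpoints can be chosen at the same height. -/
lemma exists_endpoint_agree {b : ℕ → ℝ} (hb : 0 ≤ b) (hslow : b ≤ slowSeq) {t : ℝ} {s : ℕ → ℤ}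
    (h : (t, s) ∈ lowerBdd b) (N : ℕ) :
    ∃ s' : ℕ → ℤ, (∀ i < N, s' i = s i) ∧ (t, s') ∈ Efan ∩ lowerBdd b := by
  have hmem : (t, greedySeq t s N) ∈ lowerBdd b := fun m => by
    simp only [orb_greedySeq]
    exact (le_min (hslow m) (h m)).trans (min_le_greedyOrb t s N m)
  refine ⟨greedySeq t s N, fun i hi => greedySeq_of_lt t s hi,
    mem_Efan_iff.2 ⟨lowerBdd_subset_J hb hmem, fun t' ht' hJ => ?_⟩, hmem⟩
  obtain ⟨m, hm, hmN⟩ := ((eventually_slowSeq_lt (sub_pos.2 ht') 0).and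
    (eventually_gt_atTop N)).exists
  obtain ⟨m, rfl⟩ : ∃ k, m = k + 1 := ⟨m - 1, by omega⟩
  have h1 := orb_add_F_iterate_le (sub_pos.2 ht').le (m := m + 1) fun i _ => orb_nonneg hJ i
  rw [add_sub_cancel, orb_greedySeq] at h1
  have h2 := greedyOrb_succ_le t s (Nat.lt_succ_iff.1 hmN)
  have h3 := orb_nonneg hJ (m + 1)
  rw [zero_add] at hm
  linarith

/-! ### The supremum `tstar` -/

lemma F_Finv {a : ℝ} (ha : 0 ≤ a) : F (Finv a) = a := by
  simp [Finv, F, Real.rpow_logb (by norm_num : (0 : ℝ) < 3) (by norm_num) (by linarith : 0 < a + 1)]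

lemma Finv_nonneg_s6 {a : ℝ} (ha : 0 ≤ a) : 0 ≤ Finv a :=
  Real.logb_nonneg (by norm_num) (by linarith)

lemma F_iterate_Finv_iterate {a : ℝ} (ha : 0 ≤ a) (k : ℕ) :
    0 ≤ Finv^[k] a ∧ F^[k] (Finv^[k] a) = a := by
  induction k with
  | zero => exact ⟨ha, rfl⟩
  | succ k ih =>
    rw [Function.iterate_succ_apply', Function.iterate_succ_apply]
    exact ⟨Finv_nonneg_s6 ih.1, by rw [F_Finv ih.1, ih.2]⟩

lemma Finv_iterate_le_iff {a c : ℝ} (ha : 0 ≤ a) (k : ℕ) : Finv^[k] a ≤ c ↔ a ≤ F^[k] c := by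
  conv_rhs => rw [← (F_iterate_Finv_iterate ha k).2]
  exact ((F_strictMono.iterate k).le_iff_le).symm

lemma orb_add_le (t : ℝ) (s : ℕ → ℤ) (j k : ℕ) : orb t s (j + k) ≤ F^[k] (orb t s j) := by
  induction k with
  | zero => exact le_rfl
  | succ k ih =>
    rw [Function.iterate_succ_apply']
    exact (orb_succ_le t s (j + k)).trans (F_strictMono.monotone ih)

lemma Finv_iterate_digit_le {t : ℝ} {s : ℕ → ℤ} (h : (t, s) ∈ J) (j k : ℕ) :
    Finv^[k + 1] |(shift^[j] s (k + 1) : ℝ)| ≤ orb t s (j + 1) := by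
  rw [Finv_iterate_le_iff (abs_nonneg _), shift_iterate, Function.iterate_succ_apply']
  have h1 := orb_nonneg h (j + (k + 1) + 1)
  have h2 := F_strictMono.monotone (orb_add_le t s (j + 1) k)
  rw [show j + 1 + k = j + (k + 1) by omega] at h2
  rw [orb] at h1
  linarith

lemma tstar_le_orb {t : ℝ} {s : ℕ → ℤ} (h : (t, s) ∈ J) (j : ℕ) :
    tstar (shift^[j] s) ≤ orb t s (j + 1) :=
  ciSup_le fun k => Finv_iterate_digit_le h j k

lemma orb_pos_of_orb_pos {t : ℝ} {s : ℕ → ℤ} {m : ℕ} (h : 0 < orb t s m) :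
    ∀ i ≤ m, 0 < orb t s i := by
  induction m with
  | zero => rintro i hi; rwa [Nat.le_zero.1 hi]
  | succ m ih =>
    have h1 : 0 < orb t s m := by
      rw [← F_strictMono.lt_iff_lt, F_zero]
      exact h.trans_le (orb_succ_le t s m)
    intro i hi
    rcases Nat.le_succ_iff.1 hi with h2 | rfl
    · exact ih h1 i h2
    · exact h

lemma orb_le_tstar {t : ℝ} {s : ℕ → ℤ} (h : (t, s) ∈ Efan) (j : ℕ) :
    orb t s (j + 1) ≤ tstar (shift^[j] s) + 1 := by
  obtain ⟨hJ, hmin⟩ := mem_Efan_iff.1 h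
  set a := tstar (shift^[j] s) with ha
  have ha0 : 0 ≤ a := Real.iSup_nonneg fun k => (F_iterate_Finv_iterate (abs_nonneg _) (k + 1)).1
  have hle : ∀ k, |(s (j + 1 + k) : ℝ)| ≤ F^[k + 1] a := fun k => by
    have h1 := le_ciSup (f := fun k => Finv^[k + 1] |(shift^[j] s (k + 1) : ℝ)|)
      ⟨_, Set.forall_mem_range.2 fun k => Finv_iterate_digit_le hJ j k⟩ k
    have h2 := (Finv_iterate_le_iff (abs_nonneg _) _).1 (h1.trans_eq ha.symm)
    rwa [shift_iterate, show j + (k + 1) = j + 1 + k by omega] at h2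
  by_contra! hlt
  have hcont : Continuous fun u : ℝ => orb u s (j + 1) :=
    (continuous_orb (j + 1)).comp (by fun_prop : Continuous fun u : ℝ => (u, s))
  have hev : ∀ᶠ u in 𝓝[<] t, a + 1 < orb u s (j + 1) :=
    nhdsWithin_le_nhds (hcont.continuousAt.eventually (lt_mem_nhds hlt))
  obtain ⟨u, hu, hut⟩ := (hev.and self_mem_nhdsWithin).exists
  refine hmin u hut ?_
  have hgrow : ∀ k, F^[k] a + 1 ≤ orb u s (j + 1 + k) := fun k => by
    induction k with
    | zero => exact hu.le
    | succ k ih =>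
      have h0 := F_iterate_nonneg ha0 k
      have h1 := F_strictMono.monotone ih
      have h2 := hle k
      rw [Function.iterate_succ_apply'] at h2 ⊢
      rw [← add_assoc]
      simp only [orb]
      have h3 : F (F^[k] a + 1) = 3 * F (F^[k] a) + 2 := by
        unfold F
        rw [Real.rpow_add (by norm_num), Real.rpow_one]
        ring
      have h4 := F_nonneg h0
      linarith
  rw [J_eq]
  intro m
  rcases le_or_gt m (j + 1) with hm | hm
  · exact (orb_pos_of_orb_pos (by linarith) m hm).le
  · obtain ⟨k, rfl⟩ := Nat.exists_eq_add_of_lt hm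
    have := hgrow (k + 1)
    have h0 := F_iterate_nonneg ha0 (k + 1)
    rw [← add_assoc] at this
    show 0 ≤ orb u s _
    linarith

/-! ### Boxes in `ℝ × (ℕ → ℤ)` -/

/-- The points whose height is within `ε` of that of `p` and whose itinerary agrees with that of `p`
on the first `N` entries. -/
def box (p : ℝ × (ℕ → ℤ)) (ε : ℝ) (N : ℕ) : Set (ℝ × (ℕ → ℤ)) :=
  {q | |q.1 - p.1| < ε ∧ ∀ i < N, q.2 i = p.2 i}

lemma box_eq_prod (p : ℝ × (ℕ → ℤ)) (ε : ℝ) (N : ℕ) :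
    box p ε N = Metric.ball p.1 ε ×ˢ PiNat.cylinder p.2 N := by
  ext q
  simp [box, PiNat.mem_cylinder_iff, Real.dist_eq]

lemma isOpen_box (p : ℝ × (ℕ → ℤ)) (ε : ℝ) (N : ℕ) : IsOpen (box p ε N) := by
  rw [box_eq_prod]
  exact Metric.isOpen_ball.prod (PiNat.isOpen_cylinder _ _ _)

lemma self_mem_box (p : ℝ × (ℕ → ℤ)) {ε : ℝ} (hε : 0 < ε) (N : ℕ) : p ∈ box p ε N := by
  simp [box, hε]

lemma box_mem_nhds (p : ℝ × (ℕ → ℤ)) {ε : ℝ} (hε : 0 < ε) (N : ℕ) : box p ε N ∈ 𝓝 p :=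
  (isOpen_box p ε N).mem_nhds (self_mem_box p hε N)

lemma exists_box_subset {p : ℝ × (ℕ → ℤ)} {U : Set (ℝ × (ℕ → ℤ))} (hU : U ∈ 𝓝 p) :
    ∃ ε > 0, ∃ N, box p ε N ⊆ U := by
  rw [nhds_prod_eq, mem_prod_iff] at hU
  obtain ⟨A, hA, B, hB, hAB⟩ := hU
  obtain ⟨ε, hε, hεA⟩ := Metric.mem_nhds_iff.1 hA
  obtain ⟨_, ⟨x, N, rfl⟩, hx, hNB⟩ :=
    (PiNat.isTopologicalBasis_cylinders fun _ : ℕ => ℤ).mem_nhds_iff.1 hB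
  refine ⟨ε, hε, N, ?_⟩
  rw [box_eq_prod, PiNat.mem_cylinder_iff_eq.1 hx]
  exact (Set.prod_mono hεA hNB).trans hAB

lemma tendsto_of_agree {p : ℕ → ℝ × (ℕ → ℤ)} {t : ℝ} {s : ℕ → ℤ}
    (ht : Tendsto (fun j => (p j).1) atTop (𝓝 t)) (hs : ∀ j, ∀ i < j, (p j).2 i = s i) :
    Tendsto p atTop (𝓝 (t, s)) := by
  refine ht.prodMk_nhds (tendsto_pi_nhds.2 fun i => ?_ : Tendsto (fun j => (p j).2) atTop (𝓝 s))
  refine tendsto_const_nhds.congr' ?_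
  filter_upwards [eventually_gt_atTop i] with j hj
  exact (hs j i hj).symm

lemma mem_closure_endpoints {b : ℕ → ℝ} (hb : 0 ≤ b) (hslow : b ≤ slowSeq) {p : ℝ × (ℕ → ℤ)}
    (h : p ∈ lowerBdd b) : p ∈ closure (Efan ∩ lowerBdd b) := by
  refine mem_closure_iff_nhds.2 fun U hU => ?_
  obtain ⟨ε, hε, N, hsub⟩ := exists_box_subset hU
  obtain ⟨s', hs', hmem⟩ := exists_endpoint_agree hb hslow h N
  exact ⟨(p.1, s'), hsub ⟨by simpa using hε, hs'⟩, hmem⟩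

/-! ### Bounded sets of endpoints have boundary points -/

lemma exists_boundary_step {b : ℕ → ℝ} (hb : 0 ≤ b) (hslow : b ≤ slowSeq)
    {D : Set (ℝ × (ℕ → ℤ))} (hD : D ⊆ Efan ∩ lowerBdd b) {β : ℝ} (hβ : ∀ p ∈ D, p.1 ≤ β)
    {x : ℝ × (ℕ → ℤ)} (hx : x ∈ D) (N : ℕ) {ε : ℝ} (hε : 0 < ε) :
    ∃ y ∈ D, ∃ z ∈ (Efan ∩ lowerBdd b) \ D, (∀ i < N, y.2 i = x.2 i) ∧ (∀ i < N, z.2 i = x.2 i) ∧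
      x.1 - ε < y.1 ∧ |z.1 - y.1| < ε := by
  have hline : Continuous fun u : ℝ => (u, x.2) := by fun_prop
  have hcover : ∀ u, x.1 ≤ u →
      (u, x.2) ∈ closure D ∨ (u, x.2) ∈ closure ((Efan ∩ lowerBdd b) \ D) := fun u hu => by
    rw [← Set.mem_union, ← closure_union, Set.union_sdiff_cancel hD]
    exact mem_closure_endpoints hb hslow (lowerBdd_up hu (hD hx).2)
  have hfar : (max x.1 (β + 1), x.2) ∉ closure D := fun h => by
    have h1 := closure_minimal (t := {p : ℝ × (ℕ → ℤ) | p.1 ≤ β}) hβ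
      (isClosed_le continuous_fst continuous_const) h
    have h2 : max x.1 (β + 1) ≤ β := h1
    linarith [le_max_right x.1 (β + 1)]
  obtain ⟨u, hu, huD, huD'⟩ := isPreconnected_closed_iff.1 (isPreconnected_Ici (a := x.1)) _ _
    (isClosed_closure.preimage hline) (isClosed_closure.preimage hline) hcover
    ⟨x.1, Set.self_mem_Ici, subset_closure hx⟩
    ⟨max x.1 (β + 1), Set.mem_Ici.2 (le_max_left _ _),
        (hcover _ (le_max_left x.1 (β + 1))).resolve_left hfar⟩
  obtain ⟨y, ⟨hy1, hy2⟩, hyD⟩ :=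
    mem_closure_iff_nhds.1 huD _ (box_mem_nhds (u, x.2) (half_pos hε) N)
  obtain ⟨z, ⟨hz1, hz2⟩, hzD⟩ :=
    mem_closure_iff_nhds.1 huD' _ (box_mem_nhds (u, x.2) (half_pos hε) N)
  have hu' : x.1 ≤ u := hu
  simp only [abs_lt] at hy1 hz1 ⊢
  exact ⟨y, hyD, z, hzD, hy2, hz2, by linarith, by linarith, by linarith⟩

/-- Cohesion: a nonempty set of endpoints of bounded height has a boundary point, relative to
the endpoints with orbits bounded below by a given slow sequence. -/
lemma exists_mem_closure_inter_closure {b : ℕ → ℝ} (hb : 0 ≤ b) (hslow : b ≤ slowSeq)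
    {D : Set (ℝ × (ℕ → ℤ))} (hD : D ⊆ Efan ∩ lowerBdd b) (hne : D.Nonempty) {β : ℝ}
    (hβ : ∀ p ∈ D, p.1 ≤ β) :
    ∃ y ∈ Efan ∩ lowerBdd b, y ∈ closure D ∧ y ∈ closure ((Efan ∩ lowerBdd b) \ D) := by
  choose! Y hY Z hZ hYx hZx hYt hZt using
    fun (x : D) (N : ℕ) (ε : ℝ) (hε : 0 < ε) => exists_boundary_step hb hslow hD hβ x.2 N hε
  choose! L hL using fun (x : D) (ε : ℝ) (hε : 0 < ε) =>
    exists_agree_lt_of_mem_Efan (t := x.1.1) (s := x.1.2) (hD x.2).1 hε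
  let e : ℕ → ℝ := fun j => (1 / 2) ^ j
  have he : ∀ j, 0 < e j := fun j => by positivity
  have he_succ : ∀ j, e (j + 1) = e j / 2 := fun j => by simp only [e, pow_succ]; ring
  have he_lim : Tendsto e atTop (𝓝 0) :=
    tendsto_pow_atTop_nhds_zero_of_lt_one (by norm_num) (by norm_num)
  let next : ℕ → D × ℕ → D × ℕ := fun j c =>
    let y : D := ⟨Y c.1 c.2 (e (j + 1)), hY _ _ _ (he _)⟩
    (y, max (c.2 + 1) (L y (e (j + 1))))
  obtain ⟨x₀, hx₀⟩ := hne
  let c : ℕ → D × ℕ := fun j => Nat.rec (⟨x₀, hx₀⟩, L ⟨x₀, hx₀⟩ (e 0)) next j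
  let x : ℕ → ℝ × (ℕ → ℤ) := fun j => (c j).1
  let n : ℕ → ℕ := fun j => (c j).2
  let z : ℕ → ℝ × (ℕ → ℤ) := fun j => Z (c j).1 (n j) (e (j + 1))
  have hxD : ∀ j, x j ∈ D := fun j => (c j).1.2
  have hn_succ : ∀ j, n j + 1 ≤ n (j + 1) := fun j => le_max_left _ _
  have hn_mono : Monotone n := monotone_nat_of_le_succ fun j => (Nat.le_succ _).trans (hn_succ j)
  have hn : ∀ j, j ≤ n j := fun j => by
    induction j with
    | zero => exact Nat.zero_le _
    | succ j ih => exact (Nat.succ_le_succ ih).trans (hn_succ j)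
  have hlow : ∀ j t' s', (t', s') ∈ J → (∀ i < n j, s' i = (x j).2 i) → (x j).1 - e j < t' := by
    intro j t' s' hJ hs
    refine hL (c j).1 (e j) (he j) t' s' hJ fun i hi => hs i (hi.trans_le ?_)
    cases j with
    | zero => exact le_rfl
    | succ j => exact le_max_right _ _
  have hx_agree : ∀ j k, j ≤ k → ∀ i < n j, (x k).2 i = (x j).2 i := by
    intro j k hjk
    induction k, hjk using Nat.le_induction with
    | base => exact fun _ _ => rfl
    | succ k hjk ih =>
      exact fun i hi => (hYx (c k).1 (n k) _ (he _) i (hi.trans_le (hn_mono hjk))).trans (ih i hi)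
  have hmono : Monotone fun j => (x j).1 - 2 * e j := monotone_nat_of_le_succ fun j => by
    have h1 : (x j).1 - e (j + 1) < (x (j + 1)).1 := hYt (c j).1 (n j) _ (he (j + 1))
    have h2 := he j
    rw [he_succ] at h1 ⊢
    linarith
  have hlim := tendsto_atTop_ciSup hmono ⟨β, Set.forall_mem_range.2 fun j => by
    linarith [hβ _ (hxD j), he j]⟩
  set T := ⨆ j, ((x j).1 - 2 * e j)
  have hxT : Tendsto (fun j => (x j).1) atTop (𝓝 T) := by
    simpa using hlim.add (he_lim.const_mul 2)
  let s : ℕ → ℤ := fun i => (x (i + 1)).2 i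
  have hs : ∀ j, ∀ i < n j, s i = (x j).2 i := fun j i hi => by
    rcases le_total j (i + 1) with h | h
    · exact hx_agree _ _ h i hi
    · exact (hx_agree _ _ h i (Nat.lt_of_succ_le (hn _))).symm
  have hx_tendsto : Tendsto x atTop (𝓝 (T, s)) :=
    tendsto_of_agree hxT fun j i hi => (hs j i (hi.trans_le (hn j))).symm
  have hz_tendsto : Tendsto z atTop (𝓝 (T, s)) := by
    refine tendsto_of_agree ?_ fun j i hi =>
      (hZx (c j).1 (n j) _ (he _) i (hi.trans_le (hn j))).trans (hs j i (hi.trans_le (hn j))).symm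
    have h1 : Tendsto (fun j => (z j).1 - (x (j + 1)).1) atTop (𝓝 0) :=
      squeeze_zero_norm (fun j => (hZt (c j).1 (n j) _ (he _)).le)
        ((tendsto_add_atTop_iff_nat 1).2 he_lim)
    simpa using h1.add ((tendsto_add_atTop_iff_nat 1).2 hxT)
  have hcl : (T, s) ∈ closure D := mem_closure_of_tendsto hx_tendsto (.of_forall hxD)
  have hbdd : (T, s) ∈ lowerBdd b :=
    closure_minimal (fun p hp => (hD hp).2) (isClosed_lowerBdd b) hcl
  refine ⟨(T, s), ⟨mem_Efan_iff.2 ⟨lowerBdd_subset_J hb hbdd, fun t' ht' hJ => ?_⟩, hbdd⟩, hcl,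
    mem_closure_of_tendsto hz_tendsto (.of_forall fun j => hZ _ _ _ (he _))⟩
  have h1 : Tendsto (fun j => (x j).1 - e j) atTop (𝓝 T) := by simpa using hxT.sub he_lim
  exact ht'.not_ge (le_of_tendsto' h1 fun j => (hlow j t' s hJ (hs j)).le)

/-! ### Baire category for slowly escaping endpoints -/

lemma Efan_eq_iInter :
    Efan = J ∩ ⋂ n : ℕ, {p : ℝ × (ℕ → ℤ) | (p.1 - 1 / (n + 1), p.2) ∉ J} := by
  ext ⟨t, s⟩
  simp only [mem_Efan_iff, Set.mem_inter_iff, Set.mem_iInter, Set.mem_ofPred_eq]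
  refine and_congr_right fun _ => ⟨fun h n => h _ (by simp; positivity), fun h t' ht' hJ => ?_⟩
  obtain ⟨n, hn⟩ := exists_nat_one_div_lt (sub_pos.2 ht')
  exact h n (J_up (by linarith) hJ)

lemma exists_box_constant {b : ℕ → ℝ} (hb : 0 ≤ b) (hslow : b ≤ slowSeq)
    (hne : (lowerBdd b).Nonempty) {g : ℝ × (ℕ → ℤ) → ℚ} (hg : ContinuousOn g (Efan ∩ lowerBdd b)) :
    ∃ q, ∃ v ∈ Efan ∩ lowerBdd b, ∃ δ > 0, ∃ N, ∀ y ∈ Efan ∩ lowerBdd b, y ∈ box v δ N →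
      g y = q := by
  have : PolishSpace (lowerBdd b) := (isClosed_lowerBdd b).polishSpace
  have : Nonempty (lowerBdd b) := hne.to_subtype
  let E : Set (lowerBdd b) := {y | y.1 ∈ Efan}
  have hE : IsGδ E := by
    have hEq : E = ⋂ n : ℕ, {y : lowerBdd b | (y.1.1 - 1 / ((n : ℝ) + 1), y.1.2) ∉ J} := by
      ext y
      have := lowerBdd_subset_J hb y.2
      simp only [E, Efan_eq_iInter]
      simp [this]
    rw [hEq]
    rw [J_eq]
    exact .iInter_of_isOpen fun n => (isClosed_lowerBdd 0).isOpen_compl.preimage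
      (by fun_prop : Continuous fun y : lowerBdd b => (y.1.1 - 1 / ((n : ℝ) + 1), y.1.2))
  have hdense : Dense E := fun y => by
    rw [closure_subtype]
    have h1 := mem_closure_endpoints hb hslow y.2
    convert h1 using 2
    ext p
    simp [E, and_comm]
  have hU := hE.dense_iUnion_interior_of_closed hdense
    (f := fun q : ℚ => closure {y : lowerBdd b | y.1 ∈ Efan ∧ g y = q})
    (fun _ => isClosed_closure) fun y hy => Set.mem_iUnion.2 ⟨g y, subset_closure ⟨hy, rfl⟩⟩
  obtain ⟨w, hw⟩ := hU.nonempty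
  obtain ⟨q, hq⟩ := Set.mem_iUnion.1 hw
  obtain ⟨v, hvI, hvE⟩ := mem_closure_iff.1 (hdense w) _ isOpen_interior hq
  obtain ⟨U, hUo, hU⟩ := isOpen_induced_iff.1
    (isOpen_interior (s := closure {y : lowerBdd b | y.1 ∈ Efan ∧ g y = q}))
  have hvU : v.1 ∈ U := by rw [← hU] at hvI; exact hvI
  obtain ⟨δ, hδ, N, hbox⟩ := exists_box_subset (hUo.mem_nhds hvU)
  refine ⟨q, v, ⟨hvE, v.2⟩, δ, hδ, N, fun y hy hyb => ?_⟩
  by_contra hgy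
  obtain ⟨W, hWo, hW⟩ := (continuousOn_iff'.1 hg) {q}ᶜ isOpen_compl_singleton
  have hyW : y ∈ W := (hW.subset ⟨hgy, hy⟩).1
  have hycl : (⟨y, hy.2⟩ : lowerBdd b) ∈ closure {y : lowerBdd b | y.1 ∈ Efan ∧ g y = q} := by
    have : (⟨y, hy.2⟩ : lowerBdd b) ∈ Subtype.val ⁻¹' U := hbox hyb
    rw [hU] at this
    exact interior_subset this
  obtain ⟨p, hpW, hpE, hpq⟩ := mem_closure_iff.1 hycl _ (hWo.preimage continuous_subtype_val) hyW
  exact (hW.superset ⟨hpW, hpE, p.2⟩).1 hpq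

/-! ### The space `⋃ₙ cl(Xₙ)` -/

/-- The lower bounds `F^{k-n}(1) + 2` at the times `2k² + 1`, `k > n`. -/
def fanBound (n m : ℕ) : ℝ :=
  open Classical in if ∃ k, n < k ∧ m = 2 * k ^ 2 + 1 then F^[(m / 2).sqrt - n] 1 + 2 else 0

lemma fanBound_eq {n k : ℕ} (h : n < k) : fanBound n (2 * k ^ 2 + 1) = F^[k - n] 1 + 2 := by
  rw [fanBound, if_pos ⟨k, h, rfl⟩, show (2 * k ^ 2 + 1) / 2 = k * k by rw [← sq]; omega,
    Nat.sqrt_eq]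

lemma fanBound_of_le {n m : ℕ} (h : m ≤ n) : fanBound n m = 0 := by
  rw [fanBound, if_neg]
  rintro ⟨k, hk, rfl⟩
  nlinarith

lemma fanBound_nonneg (n : ℕ) : 0 ≤ fanBound n := fun m => by
  have := F_iterate_nonneg zero_le_one ((m / 2).sqrt - n)
  rw [fanBound, Pi.zero_apply]
  split_ifs <;> linarith

lemma fanBound_le_slowSeq (n : ℕ) : fanBound n ≤ slowSeq := fun m => by
  rw [fanBound]
  split_ifs with h
  · have : F^[(m / 2).sqrt - n] 1 ≤ F^[m.sqrt] 1 := F_iterate_mono zero_le_one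
      ((Nat.sub_le _ _).trans (Nat.sqrt_le_sqrt (Nat.div_le_self _ _)))
    unfold slowSeq
    linarith
  · exact slowSeq_nonneg m

lemma fanBound_anti {n n' : ℕ} (h : n ≤ n') : fanBound n' ≤ fanBound n := fun m => by
  by_cases hm : ∃ k, n' < k ∧ m = 2 * k ^ 2 + 1
  · obtain ⟨k, hk, rfl⟩ := hm
    rw [fanBound_eq hk, fanBound_eq (h.trans_lt hk)]
    have : F^[k - n'] 1 ≤ F^[k - n] 1 := F_iterate_mono zero_le_one (by omega)
    linarith
  · rw [fanBound, if_neg hm]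
    exact fanBound_nonneg n m

lemma mem_lowerBdd_fanBound_iff {p : ℝ × (ℕ → ℤ)} (hp : p ∈ J) (n : ℕ) :
    p ∈ lowerBdd (fanBound n) ↔ ∀ k, n < k → F^[k - n] 1 + 2 ≤ orb p.1 p.2 (2 * k ^ 2 + 1) := by
  refine ⟨fun h k hk => by rw [← fanBound_eq hk]; exact h _, fun h m => ?_⟩
  by_cases hm : ∃ k, n < k ∧ m = 2 * k ^ 2 + 1
  · obtain ⟨k, hk, rfl⟩ := hm
    rw [fanBound_eq hk]
    exact h k hk
  · rw [fanBound, if_neg hm]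
    exact orb_nonneg hp m

/-- The endpoints whose orbits are bounded below by some `fanBound`. -/
def fanUnion : Set (ℝ × (ℕ → ℤ)) := ⋃ n, Efan ∩ lowerBdd (fanBound n)

lemma Xfan_subset (n : ℕ) : Xfan n ⊆ Subtype.val ⁻¹' lowerBdd (fanBound (n + 1)) := by
  rintro ⟨⟨t, s⟩, hE⟩ hx
  have hJ := (mem_Efan_iff.1 hE).1
  refine (mem_lowerBdd_fanBound_iff hJ _).2 fun k hk => ?_
  have h1 := (hx k (by omega)).trans_le (tstar_le_orb hJ (2 * k ^ 2))
  have h2 : F^[1] 1 ≤ F^[k - (n + 1)] 1 := F_iterate_mono zero_le_one (by omega)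
  rw [Function.iterate_one, F_one, ← sub_nonneg] at h2
  rw [show k - n = k - (n + 1) + 1 by omega, Function.iterate_succ_apply'] at h1
  have h3 := F_add_le h2 zero_le_two
  have h4 : F 2 = 8 := by norm_num [F]
  rw [sub_add_cancel] at h3
  dsimp only
  linarith [le_F h2]

lemma subset_Xfan (n : ℕ) : Subtype.val ⁻¹' lowerBdd (fanBound n) ⊆ Xfan n := by
  rintro ⟨⟨t, s⟩, hE⟩ hx k hk
  have h1 := (mem_lowerBdd_fanBound_iff (mem_Efan_iff.1 hE).1 n).1 hx k hk
  have h2 := orb_le_tstar hE (2 * k ^ 2)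
  dsimp only at h1 ⊢
  linarith

lemma mem_iUnion_closure_Xfan_iff (x : Efan) : x ∈ ⋃ n, closure (Xfan n) ↔ x.1 ∈ fanUnion := by
  simp only [fanUnion, Set.mem_iUnion]
  constructor
  · rintro ⟨n, hn⟩
    exact ⟨n + 1, x.2, closure_minimal (Xfan_subset n)
      ((isClosed_lowerBdd _).preimage continuous_subtype_val) hn⟩
  · rintro ⟨n, -, hn⟩
    exact ⟨n, subset_closure (subset_Xfan n hn)⟩

lemma lowerBdd_slowSeq_nonempty : (lowerBdd slowSeq).Nonempty := by
  refine ⟨(3, 0), fun m => ?_⟩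
  have h : orb 3 0 m = F^[m] 3 := by
    induction m with
    | zero => rfl
    | succ m ih => rw [Function.iterate_succ_apply', ← ih]; simp [orb]
  have h1 := F_iterate_add_le zero_le_one zero_le_two m.sqrt
  have h2 : (2 : ℝ) ≤ F^[m.sqrt] 2 := F_iterate_mono zero_le_two (Nat.zero_le _)
  have h3 : F^[m.sqrt] 3 ≤ F^[m] 3 :=
    F_iterate_mono (by norm_num : (0 : ℝ) ≤ 3) (Nat.sqrt_le_self m)
  norm_num at h1
  rw [h, slowSeq]
  linarith

/-- Every continuous rational-valued function on `fanUnion` is constant on a nonempty open set. -/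
lemma exists_box_constant_fanUnion {g : ℝ × (ℕ → ℤ) → ℚ} (hg : ContinuousOn g fanUnion) :
    ∃ q, ∃ v ∈ fanUnion, ∃ δ > 0, ∃ N, ∀ y ∈ fanUnion, y ∈ box v δ N → g y = q := by
  have hsub : ∀ n, Efan ∩ lowerBdd (fanBound n) ⊆ fanUnion := Set.subset_iUnion _
  obtain ⟨q, v, hv, δ₀, hδ₀, N₀, hconst⟩ := exists_box_constant (fanBound_nonneg 0)
    (fanBound_le_slowSeq 0) (lowerBdd_slowSeq_nonempty.mono
      (lowerBdd_anti (fanBound_le_slowSeq 0))) (hg.mono (hsub 0))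
  set δ := δ₀ / 2 with hδ_def
  have hδ : 0 < δ := half_pos hδ₀
  obtain ⟨m₀, hm₀⟩ := eventually_atTop.1 (eventually_slowSeq_lt hδ 0)
  set N₁ := max N₀ m₀
  refine ⟨q, v, hsub 0 hv, δ, hδ, N₁, fun x₀ hx₀ hx₀v => ?_⟩
  by_contra hne
  obtain ⟨O, hO, hxO, hqO⟩ := exists_isClopen_of_totally_separated hne
  obtain ⟨W, hWo, hW⟩ := continuousOn_iff'.1 hg O hO.isOpen
  obtain ⟨ε, hε, N₂, hbox⟩ := exists_box_subset (hWo.mem_nhds (hW.subset ⟨hxO, hx₀⟩).1)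
  obtain ⟨n, hx₀E, hx₀n⟩ := Set.mem_iUnion.1 hx₀
  have hx₀J := (mem_Efan_iff.1 hx₀E).1
  -- replace the tail of `x₀` so that its orbit eventually dominates `fanBound 0`
  obtain ⟨K, hKN₁, hKN₂, hK⟩ : ∃ K, N₁ ≤ K ∧ N₂ ≤ K ∧ 0 < orb x₀.1 x₀.2 K := by
    let k := n + N₁ + N₂ + 1
    have hk : k ≤ 2 * k ^ 2 + 1 := by nlinarith
    refine ⟨2 * k ^ 2 + 1, by omega, by omega, ?_⟩
    have h1 := (mem_lowerBdd_fanBound_iff hx₀J n).1 hx₀n k (by omega)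
    linarith [F_iterate_nonneg zero_le_one (k - n)]
  obtain ⟨i₀, hi₀⟩ := eventually_atTop.1 (eventually_slowSeq_lt hK K)
  set M := K + i₀
  let s₀ : ℕ → ℤ := fun i => if i < K then x₀.2 i else 0
  have hs₀ : ∀ i < K, s₀ i = x₀.2 i := fun i hi => if_pos hi
  have horb : ∀ i, orb x₀.1 s₀ (K + i) = F^[i] (orb x₀.1 x₀.2 K) := fun i => by
    induction i with
    | zero => exact orb_congr _ hs₀
    | succ i ih =>
      rw [Function.iterate_succ_apply', ← ih, ← add_assoc]
      simp [orb, s₀]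
  let b : ℕ → ℝ := fun m => if M ≤ m then fanBound 0 m else 0
  have hb_le : b ≤ fanBound 0 := fun m => by
    simp only [b]
    split_ifs
    · exact le_rfl
    · exact fanBound_nonneg 0 m
  have hb : 0 ≤ b := fun m => by
    simp only [b]
    split_ifs
    · exact fanBound_nonneg 0 m
    · exact le_rfl
  have hslow : b ≤ slowSeq := hb_le.trans (fanBound_le_slowSeq 0)
  have hx₀b : (x₀.1, s₀) ∈ lowerBdd b := fun m => by
    rcases lt_or_ge m K with hm | hm
    · have : ¬ M ≤ m := by omega
      simp only [b, this, if_false]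
      rw [orb_congr _ fun i hi => hs₀ i (hi.trans hm)]
      exact orb_nonneg hx₀J m
    · obtain ⟨i, rfl⟩ := Nat.exists_eq_add_of_le hm
      simp only [horb, b]
      split_ifs with h
      · linarith [hi₀ i (by omega), fanBound_le_slowSeq 0 (K + i)]
      · exact F_iterate_nonneg hK.le i
  obtain ⟨s, hs, hsE, hsb⟩ := exists_endpoint_agree hb hslow hx₀b M
  have hsub' : Efan ∩ lowerBdd b ⊆ fanUnion := fun p hp => by
    refine hsub M ⟨hp.1, fun m => le_trans ?_ (hp.2 m)⟩
    simp only [b]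
    split_ifs with h
    · exact fanBound_anti (Nat.zero_le M) m
    · exact (fanBound_of_le (by omega)).le
  have hsO : g (x₀.1, s) ∈ O := by
    refine (hW.superset ⟨hbox ⟨by simpa using hε, fun i hi => ?_⟩, hsub' ⟨hsE, hsb⟩⟩).1
    exact (hs i (by omega)).trans (hs₀ i (by omega))
  -- push `x₀` up by `δ` inside the clopen preimage of `O`
  let D : Set (ℝ × (ℕ → ℤ)) :=
    {p | p ∈ Efan ∩ lowerBdd b ∧ g p ∈ O ∧ (∀ i < M, p.2 i = s i) ∧ p.1 ≤ x₀.1 + δ}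
  obtain ⟨y, hy, hyD, hyD'⟩ := exists_mem_closure_inter_closure hb hslow (D := D)
    (fun p hp => hp.1) ⟨(x₀.1, s), ⟨hsE, hsb⟩, hsO, fun _ _ => rfl, by simpa using hδ.le⟩
    fun p hp => hp.2.2.2
  have hyO : g y ∈ O := hO.isClosed.closure_subset_iff.2 (Set.image_subset_iff.2 fun p hp => hp.2.1)
    (((hg y (hsub' hy)).mono fun p hp => hsub' hp.1).mem_closure_image hyD)
  have hyt : y.1 ≤ x₀.1 + δ :=
    closure_minimal (t := {p : ℝ × (ℕ → ℤ) | p.1 ≤ x₀.1 + δ}) (fun p hp => hp.2.2.2)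
      (isClosed_le continuous_fst continuous_const) hyD
  have hys : ∀ i < M, y.2 i = s i := fun i hi => by
    obtain ⟨p, hp, hpD⟩ := mem_closure_iff_nhds.1 hyD _ (box_mem_nhds y one_pos M)
    rw [← hp.2 i hi, hpD.2.2.1 i hi]
  have hyt' : x₀.1 + δ ≤ y.1 := by
    by_contra! hlt
    obtain ⟨p, ⟨hpW, hpt, hps⟩, hpP, hpD⟩ := mem_closure_iff_nhds.1 hyD' _
      (inter_mem (hWo.mem_nhds (hW.subset ⟨hyO, hsub' hy⟩).1) (box_mem_nhds y (sub_pos.2 hlt) M))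
    refine hpD ⟨hpP, (hW.superset ⟨hpW, hsub' hpP⟩).1, fun i hi => (hps i hi).trans (hys i hi), ?_⟩
    linarith [(abs_lt.1 hpt).2]
  have hyt_eq : y.1 = x₀.1 + δ := le_antisymm hyt hyt'
  have hyv : ∀ i < N₁, y.2 i = v.2 i := fun i hi => by
    rw [hys i (by omega), hs i (by omega), hs₀ i (by omega), hx₀v.2 i hi]
  have hx₀t := abs_lt.1 hx₀v.1
  refine hqO (hconst y ⟨hy.1, fun m => ?_⟩ ⟨abs_lt.2 ⟨by linarith, by linarith⟩, fun i hi =>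
    hyv i (hi.trans_le (le_max_left _ _))⟩ ▸ hyO)
  rcases le_or_gt M m with hm | hm
  · have := hy.2 m
    simpa only [b, hm, if_true] using this
  rcases le_or_gt m₀ m with hm' | hm'
  · have h1 := orb_add_F_iterate_le hδ.le (m := m) fun i _ =>
      orb_nonneg (mem_Efan_iff.1 hsE).1 i
    rw [← hyt_eq, ← orb_congr y.1 fun i hi => hys i (hi.trans hm)] at h1
    have h2 := hm₀ m hm'
    rw [zero_add] at h2
    linarith [orb_nonneg (mem_Efan_iff.1 hsE).1 m, fanBound_le_slowSeq 0 m]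
  · refine (hv.2 m).trans ?_
    rw [← orb_congr v.1 fun i hi => hyv i (hi.trans (hm'.trans_le (le_max_right _ _)))]
    exact orb_mono (by linarith) _ _

/-- Y = ⋃ₙ cl(Xₙ) (closures in E(𝓕)) is not homeomorphic to ℚ × 𝔈_c. -/
theorem Y_not_homeomorphic_rat_prod_Ec :
    ¬ Nonempty (↥(⋃ n : ℕ, closure (Xfan n)) ≃ₜ (ℚ × Ec)) := by
  rintro ⟨h⟩
  let ι : ↥(⋃ n : ℕ, closure (Xfan n)) → ℝ × (ℕ → ℤ) := fun y => y.1.1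
  have hι : IsEmbedding ι := IsEmbedding.subtypeVal.comp IsEmbedding.subtypeVal
  have hrange : Set.range ι = fanUnion := by
    ext p
    constructor
    · rintro ⟨y, rfl⟩
      exact (mem_iUnion_closure_Xfan_iff _).1 y.2
    · intro hp
      obtain ⟨n, hpE, -⟩ := Set.mem_iUnion.1 hp
      exact ⟨⟨⟨p, hpE⟩, (mem_iUnion_closure_Xfan_iff _).2 hp⟩, rfl⟩
  let g : ℝ × (ℕ → ℤ) → ℚ := Function.extend ι (fun y => (h y).1) 0
  have hgι : ∀ y, g (ι y) = (h y).1 := hι.injective.extend_apply _ _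
  have hg : ContinuousOn g fanUnion := by
    rw [← hrange]
    rintro _ ⟨y, rfl⟩
    rw [ContinuousWithinAt, ← hι.map_nhds_eq, tendsto_map'_iff, hgι]
    refine Tendsto.congr (fun y => (hgι y).symm) ?_
    exact (continuous_fst.comp h.continuous).continuousAt
  obtain ⟨q, v, hv, δ, hδ, N, hconst⟩ := exists_box_constant_fanUnion hg
  obtain ⟨y, rfl⟩ := hrange.superset hv
  have hcont : Continuous fun r : ℚ => ι (h.symm (r, (h y).2)) :=
    hι.continuous.comp (h.symm.continuous.comp (by fun_prop))
  have hev : ∀ᶠ r in 𝓝 (h y).1, r = q := by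
    have h1 : ∀ᶠ r in 𝓝 (h y).1, ι (h.symm (r, (h y).2)) ∈ box (ι y) δ N :=
      hcont.continuousAt.eventually_mem (by simpa using box_mem_nhds (ι y) hδ N)
    filter_upwards [h1] with r hr
    have h2 := hconst _ (hrange.subset ⟨_, rfl⟩) hr
    rwa [hgι, h.apply_symm_apply] at h2
  obtain ⟨r, hr, hne⟩ :=
    ((hev.filter_mono nhdsWithin_le_nhds).and (self_mem_nhdsWithin (s := {(h y).1}ᶜ))).exists
  exact hne (hr.trans hev.self_of_nhds.symm)
end
end
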